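/- arXiv:1201.6578 — 3 statements merged into one kernel-verified Lean document; each statement's English description precedes it below -/
import Mathlib

section
/- Let G be a simple graph on a finite vertex type V, let ρ, δ : V → ℕ take values in {0, 1}, let G' be the augmented graph of G with respect to (ρ, δ) with new vertices s and t, and let k be the sum over all vertices v of δ(v). If G has a partial orientation realizing (ρ, δ), then G' contains k pairwise edge-disjoint paths from s to t, each of length exactly 3. -/
/-- A partial orientation of `G` realizing `(ρ, δ)`. -/
def PartialOrientation {V : Type*} (G : SimpleGraph V) (ρ δ : V → ℕ)
    (D : V → V → Prop) : Prop :=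
  (∀ u v, D u v → G.Adj u v) ∧
  (∀ u v, ¬ (D u v ∧ D v u)) ∧
  (∀ v, {w | D v w}.ncard = δ v ∧ {w | D w v}.ncard = ρ v)

/-- The augmented graph of `G` with respect to `(ρ, δ)`: the vertex set is
`V ⊕ Bool`, where `Sum.inr false` is the new vertex `s` and `Sum.inr true` is
the new vertex `t`.  Edges are those of `G`, together with `s ~ v` whenever
`δ v = 1` and `t ~ v` whenever `ρ v = 1`; `s` and `t` are not adjacent. -/
def augGraph {V : Type*} (G : SimpleGraph V) (ρ δ : V → ℕ) :
    SimpleGraph (V ⊕ Bool) :=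
  SimpleGraph.fromRel (fun x y =>
    match x, y with
    | Sum.inl u, Sum.inl v => G.Adj u v
    | Sum.inr false, Sum.inl v => δ v = 1
    | Sum.inr true, Sum.inl v => ρ v = 1
    | _, _ => False)

/-- An arc of a partial orientation forces out-degree one at its tail and in-degree one at its
head. -/
lemma PartialOrientation.eq_one_of_arc {V : Type*} [Finite V] {G : SimpleGraph V} {ρ δ : V → ℕ}
    {D : V → V → Prop} (hD : PartialOrientation G ρ δ D) (hρ : ∀ v, ρ v ≤ 1) (hδ : ∀ v, δ v ≤ 1)
    {u v : V} (h : D u v) : δ u = 1 ∧ ρ v = 1 := by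
  have hu : 0 < {w | D u w}.ncard := (Set.ncard_pos (Set.toFinite _)).2 ⟨v, h⟩
  have hv : 0 < {w | D w v}.ncard := (Set.ncard_pos (Set.toFinite _)).2 ⟨u, h⟩
  rw [(hD.2.2 u).1] at hu
  rw [(hD.2.2 v).2] at hv
  exact ⟨le_antisymm (hδ u) hu, le_antisymm (hρ v) hv⟩

/-- If all in-degrees are at most one, two arcs with the same head have the same tail. -/
lemma PartialOrientation.tail_unique {V : Type*} [Finite V] {G : SimpleGraph V} {ρ δ : V → ℕ}
    {D : V → V → Prop} (hD : PartialOrientation G ρ δ D) (hρ : ∀ v, ρ v ≤ 1)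
    {u u' v : V} (h : D u v) (h' : D u' v) : u = u' :=
  (Set.ncard_le_one (Set.toFinite _)).1 ((hD.2.2 v).2.trans_le (hρ v)) u h u' h'

/-- The walk `s, u, v, t` in the augmented graph. -/
def augWalk {V : Type*} {G : SimpleGraph V} {ρ δ : V → ℕ} {u v : V}
    (hu : δ u = 1) (huv : G.Adj u v) (hv : ρ v = 1) :
    (augGraph G ρ δ).Walk (Sum.inr false) (Sum.inr true) :=
  .cons (v := Sum.inl u) (by simp [augGraph, hu]) <|
    .cons (v := Sum.inl v) (by simp [augGraph, huv, huv.ne]) <|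
      .cons (by simp [augGraph, hv]) .nil

lemma augWalk_support {V : Type*} {G : SimpleGraph V} {ρ δ : V → ℕ} {u v : V}
    (hu : δ u = 1) (huv : G.Adj u v) (hv : ρ v = 1) :
    (augWalk hu huv hv).support = [Sum.inr false, Sum.inl u, Sum.inl v, Sum.inr true] :=
  rfl

lemma augWalk_edges {V : Type*} {G : SimpleGraph V} {ρ δ : V → ℕ} {u v : V}
    (hu : δ u = 1) (huv : G.Adj u v) (hv : ρ v = 1) :
    (augWalk hu huv hv).edges =
      [s(Sum.inr false, Sum.inl u), s(Sum.inl u, Sum.inl v), s(Sum.inl v, Sum.inr true)] :=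
  rfl

theorem orientation_gives_paths {V : Type*} [Fintype V]
    (G : SimpleGraph V) (ρ δ : V → ℕ)
    (hρ : ∀ v, ρ v ≤ 1) (hδ : ∀ v, δ v ≤ 1)
    (k : ℕ) (hk : k = ∑ v, δ v)
    (h : ∃ D : V → V → Prop, PartialOrientation G ρ δ D) :
    ∃ P : Fin k → (augGraph G ρ δ).Walk (Sum.inr false) (Sum.inr true),
      (∀ i, (P i).IsPath ∧ (P i).length = 3) ∧
      (∀ i j, i ≠ j → ∀ e, e ∈ (P i).edges → e ∉ (P j).edges) := by
  obtain ⟨D, hD⟩ := h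
  have hout : ∀ v : {v // δ v = 1}, ∃ w, D v w := fun v =>
    (Set.ncard_pos (s := {w | D v w}) (Set.toFinite _)).1 (by rw [(hD.2.2 v).1, v.2]; exact one_pos)
  choose f hf using hout
  have hcard : k = Nat.card {v // δ v = 1} := by
    classical
    rw [hk, Nat.card_eq_fintype_card, Fintype.card_subtype, Finset.card_filter]
    refine Finset.sum_congr rfl fun v _ => ?_
    have := hδ v
    split_ifs <;> omega
  let e : Fin k ≃ {v // δ v = 1} := (finCongr hcard).trans (Finite.equivFin _).symm
  refine ⟨fun i => augWalk (e i).2 (hD.1 _ _ (hf (e i))) (hD.eq_one_of_arc hρ hδ (hf (e i))).2,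
    fun i => ⟨?_, rfl⟩, fun i j hij => ?_⟩
  · have := (hD.1 _ _ (hf (e i))).ne
    simp [augWalk_support, SimpleGraph.Walk.isPath_def, this]
  · have htail : (e i : V) ≠ e j := fun h => hij (e.injective (Subtype.ext h))
    have hhead : f (e i) ≠ f (e j) := fun h =>
      htail (hD.tail_unique hρ (hf (e i)) (h ▸ hf (e j)))
    have hrev : (e i : V) = f (e j) → f (e i) ≠ e j := fun h h' =>
      hD.2.1 (e i) (e j) ⟨h' ▸ hf (e i), h ▸ hf (e j)⟩
    simpa [augWalk_edges, htail, hhead] using hrev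
end

section
/- Let G be a simple graph on a finite vertex type V, let ρ, δ : V → ℕ take values in {0, 1}, let G' be the augmented graph of G with respect to (ρ, δ) with new vertices s and t, and suppose the sum over all vertices v of δ(v) equals the sum over all vertices v of ρ(v), with common value k. If G' contains k pairwise edge-disjoint paths from s to t, each of length exactly 3, then G has a partial orientation realizing (ρ, δ). -/
/-- A walk of length three from `s` to `t` in the augmented graph runs along an edge of `G`. -/
theorem exists_edges_of_length_eq_three {V : Type*} {G : SimpleGraph V} {ρ δ : V → ℕ}
    (p : (augGraph G ρ δ).Walk (Sum.inr false) (Sum.inr true)) (hp : p.length = 3) :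
    ∃ u v, δ u = 1 ∧ ρ v = 1 ∧ G.Adj u v ∧
      s(Sum.inr false, Sum.inl u) ∈ p.edges ∧ s(Sum.inl u, Sum.inl v) ∈ p.edges ∧
      s(Sum.inr true, Sum.inl v) ∈ p.edges := by
  obtain _ | ⟨h, _ | ⟨h', _ | ⟨h'', _ | ⟨_, _⟩⟩⟩⟩ := p <;>
    simp only [SimpleGraph.Walk.length_cons, SimpleGraph.Walk.length_nil] at hp <;> try omega
  rename_i a b
  rcases a with u | a
  · rcases b with v | b
    · refine ⟨u, v, ?_, ?_, ?_, by simp, by simp, by simp [Sym2.eq_swap]⟩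
      · simpa [augGraph] using h
      · simpa [augGraph] using h''
      · simpa [augGraph, G.adj_comm] using h'.2
    · cases b <;> simp [augGraph] at h''
  · cases a <;> simp [augGraph] at h

/-- An injective family of `∑ v, d v` vertices with `d v = 1`, where `d ≤ 1`, hits each such vertex
exactly once. -/
theorem ncard_matched_eq {V : Type*} [Fintype V] {d : V → ℕ} (hd : ∀ v, d v ≤ 1) {k : ℕ}
    (hk : k = ∑ v, d v) {f : Fin k → V} (hf : f.Injective) (hfd : ∀ i, d (f i) = 1)
    (g : Fin k → V) (v : V) : {w | ∃ i, f i = v ∧ g i = w}.ncard = d v := by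
  classical
  by_cases hv : d v = 1
  · have hcard : (Finset.univ.filter fun v => d v = 1).card = k := by
      rw [hk, Finset.card_filter]
      refine Finset.sum_congr rfl fun v _ => ?_
      have := hd v
      split_ifs <;> omega
    have himage : Finset.univ.image f = Finset.univ.filter fun v => d v = 1 := by
      refine Finset.eq_of_subset_of_card_le (fun x hx => ?_) ?_
      · obtain ⟨i, -, rfl⟩ := Finset.mem_image.1 hx
        simp [hfd]
      · rw [hcard, Finset.card_image_of_injective _ hf, Finset.card_fin]
    have hmem : v ∈ Finset.univ.image f := by simp [himage, hv]
    obtain ⟨i, -, rfl⟩ := Finset.mem_image.1 hmem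
    simp [hf.eq_iff, hv]
  · have hempty : {w | ∃ i, f i = v ∧ g i = w} = ∅ := by
      ext w
      simp only [Set.mem_ofPred_eq, Set.mem_empty_iff_false, iff_false]
      rintro ⟨i, rfl, -⟩
      exact hv (hfd i)
    have := hd v
    rw [hempty, Set.ncard_empty]
    omega

theorem paths_give_orientation {V : Type*} [Fintype V]
    (G : SimpleGraph V) (ρ δ : V → ℕ)
    (hρ : ∀ v, ρ v ≤ 1) (hδ : ∀ v, δ v ≤ 1)
    (k : ℕ) (hkδ : k = ∑ v, δ v) (hkρ : k = ∑ v, ρ v)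
    (h : ∃ P : Fin k → (augGraph G ρ δ).Walk (Sum.inr false) (Sum.inr true),
      (∀ i, (P i).IsPath ∧ (P i).length = 3) ∧
      (∀ i j, i ≠ j → ∀ e, e ∈ (P i).edges → e ∉ (P j).edges)) :
    ∃ D : V → V → Prop, PartialOrientation G ρ δ D := by
  obtain ⟨P, hP, hdisj⟩ := h
  choose f g hfδ hgρ hadj hsf hfg htg using
    fun i => exists_edges_of_length_eq_three (P i) (hP i).2
  have hf : f.Injective := fun i j hij => by
    by_contra hne
    exact hdisj i j hne _ (hsf i) (hij ▸ hsf j)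
  have hg : g.Injective := fun i j hij => by
    by_contra hne
    exact hdisj i j hne _ (htg i) (hij ▸ htg j)
  refine ⟨fun u v => ∃ i, f i = u ∧ g i = v, ?_, ?_, fun v => ⟨?_, ?_⟩⟩
  · rintro _ _ ⟨i, rfl, rfl⟩
    exact hadj i
  · rintro _ _ ⟨⟨i, rfl, rfl⟩, j, hfj, hgj⟩
    rcases eq_or_ne i j with rfl | hne
    · exact (hadj i).ne hfj
    · refine hdisj i j hne _ (hfg i) ?_
      rw [Sym2.eq_swap, ← hfj, ← hgj]
      exact hfg j
  · exact ncard_matched_eq hδ hkδ hf hfδ g v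
  · simpa only [and_comm] using ncard_matched_eq hρ hkρ hg hgρ f v
end

section
/- Let G be a simple graph on a finite vertex type V, let ρ, δ : V → ℕ, and let S ⊆ V. If G has a partial orientation realizing (ρ, δ), then the mirrored graph of G over S has a partial orientation realizing (ρ', δ'), where ρ'(inl v) = ρ(v), δ'(inl v) = δ(v), ρ'(inr v) = δ(v), and δ'(inr v) = ρ(v) for every v ∈ V. (Such an orientation is obtained by orienting the first copy as in G, reversing every directed edge in the second copy, and leaving all matching edges undirected.) -/
/-- The mirrored graph of `G` over `S`: two disjoint copies of `G` on
`V ⊕ V`, together with the matching edges `{inl v, inr v}` for `v ∈ S`. -/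
def mirrorGraph {V : Type*} (G : SimpleGraph V) (S : Set V) :
    SimpleGraph (V ⊕ V) :=
  SimpleGraph.fromRel (fun x y =>
    match x, y with
    | Sum.inl u, Sum.inl v => G.Adj u v
    | Sum.inr u, Sum.inr v => G.Adj u v
    | Sum.inl u, Sum.inr v => u = v ∧ v ∈ S
    | _, _ => False)

theorem mirror_orientation {V : Type*} [Fintype V] (G : SimpleGraph V)
    (ρ δ : V → ℕ) (S : Set V)
    (h : ∃ D : V → V → Prop, PartialOrientation G ρ δ D) :
    ∃ D' : (V ⊕ V) → (V ⊕ V) → Prop,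
      PartialOrientation (mirrorGraph G S) (Sum.elim ρ δ) (Sum.elim δ ρ) D' := by
  obtain ⟨D, hadj, hanti, hdeg⟩ := h
  refine ⟨Sum.LiftRel D (fun u v => D v u), ?_, ?_, ?_⟩
  · rintro _ _ (⟨huv⟩ | ⟨hvu⟩)
    · have huv := hadj _ _ huv
      simp [mirrorGraph, huv, huv.ne]
    · have hvu := hadj _ _ hvu
      simp [mirrorGraph, hvu, hvu.ne']
  · rintro (u | u) (v | v) ⟨huv, hvu⟩ <;> simp at huv hvu
    · exact hanti u v ⟨huv, hvu⟩
    · exact hanti u v ⟨hvu, huv⟩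
  · have hinl (p : V → Prop) (q : V ⊕ V → Prop) (hl : ∀ w, q (Sum.inl w) ↔ p w)
        (hr : ∀ w, ¬ q (Sum.inr w)) : {w | q w}.ncard = {w | p w}.ncard := by
      rw [← Set.ncard_image_of_injective {w | p w} (Sum.inl_injective (β := V))]
      congr 1
      ext (w | w) <;> simp [hl, hr]
    have hinr (p : V → Prop) (q : V ⊕ V → Prop) (hl : ∀ w, ¬ q (Sum.inl w))
        (hr : ∀ w, q (Sum.inr w) ↔ p w) : {w | q w}.ncard = {w | p w}.ncard := by
      rw [← Set.ncard_image_of_injective {w | p w} (Sum.inr_injective (α := V))]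
      congr 1
      ext (w | w) <;> simp [hl, hr]
    rintro (v | v)
    · exact ⟨(hinl (D v) _ (by simp) (by simp)).trans (hdeg v).1,
        (hinl (D · v) _ (by simp) (by simp)).trans (hdeg v).2⟩
    · exact ⟨(hinr (D · v) _ (by simp) (by simp)).trans (hdeg v).2,
        (hinr (D v) _ (by simp) (by simp)).trans (hdeg v).1⟩
end
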